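/- Let Δ ⊂ ℝ² be a 2-dimensional lattice polytope which is maximal and nonhyperelliptic. Then r − r^{(1)} − c(Δ) ≤ 6, where r and r^{(1)} are the numbers of boundary lattice points of Δ and of Δ^{(1)} respectively, and c(Δ) is the number of column vectors of Δ. -/

import Mathlib

noncomputable section

/-- The embedding of the integer lattice `ℤ²` into the plane `ℝ²`. -/
def toR2 (p : ℤ × ℤ) : ℝ × ℝ := ((p.1 : ℝ), (p.2 : ℝ))

/-- A lattice polytope in `ℝ²`: the convex hull of a finite set of lattice points. -/
def IsLatticePolytope (Δ : Set (ℝ × ℝ)) : Prop :=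
  ∃ S : Finset (ℤ × ℤ), Δ = convexHull ℝ (toR2 '' (S : Set (ℤ × ℤ)))

/-- The lattice points of `Δ`. -/
def latticePts (Δ : Set (ℝ × ℝ)) : Set (ℤ × ℤ) := {p | toR2 p ∈ Δ}

/-- The interior lattice points of `Δ`. -/
def intPts (Δ : Set (ℝ × ℝ)) : Set (ℤ × ℤ) := {p | toR2 p ∈ interior Δ}

/-- The boundary lattice points of `Δ`. -/
def bdPts (Δ : Set (ℝ × ℝ)) : Set (ℤ × ℤ) := {p | toR2 p ∈ frontier Δ}

/-- `Δ⁽¹⁾`: the convex hull of the interior lattice points of `Δ`. -/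
def interiorHull (Δ : Set (ℝ × ℝ)) : Set (ℝ × ℝ) := convexHull ℝ (toR2 '' intPts Δ)

/-- `Δ` is maximal: any lattice polytope strictly containing `Δ` has a different set of
interior lattice points. -/
def IsMaximalPolytope (Δ : Set (ℝ × ℝ)) : Prop :=
  ∀ Δ' : Set (ℝ × ℝ), IsLatticePolytope Δ' → Δ ⊂ Δ' → intPts Δ' ≠ intPts Δ

/-- `Δ` is hyperelliptic: its interior lattice points are collinear. -/
def IsHyperelliptic (Δ : Set (ℝ × ℝ)) : Prop := Collinear ℝ (toR2 '' intPts Δ)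

/-- A facet (edge) of `Δ`: a one-dimensional exposed face. -/
def IsFacet (Δ τ : Set (ℝ × ℝ)) : Prop :=
  IsExposed ℝ Δ τ ∧ Collinear ℝ τ ∧ ¬ τ.Subsingleton

/-- `v` is a column vector of `Δ`: `v ≠ 0` and there is a facet `τ` (the base facet)
such that `v + ((Δ ∖ τ) ∩ ℤ²) ⊆ Δ`. -/
def IsColumnVector (Δ : Set (ℝ × ℝ)) (v : ℤ × ℤ) : Prop :=
  v ≠ 0 ∧ ∃ τ : Set (ℝ × ℝ), IsFacet Δ τ ∧
    ∀ p : ℤ × ℤ, toR2 p ∈ Δ \ τ → toR2 (p + v) ∈ Δ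

/-- `c(Δ)`: the number of column vectors of `Δ`. -/
def colCount (Δ : Set (ℝ × ℝ)) : ℕ := {v : ℤ × ℤ | IsColumnVector Δ v}.ncard

/-- The determinant of two integer vectors. -/
def det2 (a b : ℤ × ℤ) : ℤ := a.1 * b.2 - a.2 * b.1

/-- `D` is the set of rays of a complete unimodular fan, with counterclockwise successor `S`. -/
def IsFan (D : Finset (ℤ × ℤ)) (S : ℤ × ℤ → ℤ × ℤ) : Prop :=
  ∀ w ∈ D, S w ∈ D ∧ det2 w (S w) = 1 ∧ ∀ v ∈ D, ¬ (0 < det2 w v ∧ 0 < det2 v (S w))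

namespace IsFan

variable {D : Finset (ℤ × ℤ)} {S : ℤ × ℤ → ℤ × ℤ}

theorem injOn (h : IsFan D S) : Set.InjOn S D := by
  intro v hv w hw hvw
  obtain ⟨-, h1, h2⟩ := h v hv
  obtain ⟨-, h3, h4⟩ := h w hw
  have h2 := h2 w hw
  have h4 := h4 v hv
  rw [hvw] at h1 h2
  set s := S w
  simp only [h1, h3, not_lt, zero_lt_one, and_true] at h2 h4
  simp only [det2] at h1 h2 h3 h4
  have h5 : v.1 * w.2 - v.2 * w.1 = 0 := by linarith
  ext
  · linear_combination w.1 * h1 - v.1 * h3 - s.1 * h5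
  · linear_combination w.2 * h1 - v.2 * h3 - s.2 * h5

theorem exists_pred (h : IsFan D S) {w : ℤ × ℤ} (hw : w ∈ D) : ∃ p ∈ D, S p = w := by
  have := Finset.surjOn_of_injOn_of_card_le S (fun x hx => (h x hx).1) h.injOn le_rfl
  obtain ⟨p, hp, rfl⟩ := this hw
  exact ⟨p, hp, rfl⟩

theorem add_succ {p w q : ℤ × ℤ} (h1 : det2 p w = 1) (h2 : det2 w q = 1) :
    p.1 + q.1 = det2 p q * w.1 ∧ p.2 + q.2 = det2 p q * w.2 := by
  simp only [det2] at *
  constructor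
  · linear_combination -p.1 * h2 - q.1 * h1
  · linear_combination -p.2 * h2 - q.2 * h1

theorem contract (h : IsFan D S) {p : ℤ × ℤ} (hp : p ∈ D) (hb : det2 p (S (S p)) = 1) :
    IsFan (D.erase (S p)) (Function.update S p (S (S p))) ∧
      ∑ v ∈ D, det2 v (S (S v)) =
        ∑ v ∈ D.erase (S p), det2 v (Function.update S p (S (S p))
          (Function.update S p (S (S p)) v)) + 3 := by
  obtain ⟨hw, hpw, hpn⟩ := h p hp
  obtain ⟨hq, hwq, hwn⟩ := h _ hw
  obtain ⟨hqs, hqq, hqn⟩ := h _ hq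
  obtain ⟨pp, hpp, hppe⟩ := h.exists_pred hp
  obtain ⟨-, hppd, -⟩ := h pp hpp
  rw [hppe] at hppd
  obtain ⟨a1, a2⟩ := add_succ hpw hwq
  rw [hb, one_mul] at a1 a2
  generalize hwdef : S p = w at *
  generalize hqdef : S w = q at *
  have self (a : ℤ × ℤ) : det2 a a = 0 := by simp [det2, mul_comm]
  have hne_pw : p ≠ w := by rintro rfl; simp [self] at hpw
  have hne_wq : w ≠ q := by rintro rfl; simp [self] at hwq
  have hne_pq : p ≠ q := by rintro rfl; simp [self] at hb
  have hne_ppp : pp ≠ p := by rintro rfl; simp [self] at hppd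
  have hne_ppw : pp ≠ w := by rintro rfl; exact hne_pq (by rw [← hppe, hqdef])
  have hsucc : ∀ v ∈ D, S v = w → v = p := fun v hv hvw => h.injOn hv hp (by rw [hvw, hwdef])
  have hpred : ∀ v ∈ D, S v = p → v = pp := fun v hv hvw => h.injOn hv hpp (by rw [hvw, hppe])
  have hup : Function.update S p q p = q := Function.update_self ..
  have hun : ∀ v, v ≠ p → Function.update S p q v = S v :=
    fun v hv => Function.update_of_ne hv _ _
  refine ⟨?_, ?_⟩
  · intro v hv
    rw [Finset.mem_erase] at hv
    by_cases hvp : v = p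
    · subst hvp
      rw [hup]
      refine ⟨Finset.mem_erase.2 ⟨hne_wq.symm, hq⟩, hb, ?_⟩
      rintro u hu ⟨u1, u2⟩
      rw [Finset.mem_erase] at hu
      have n1 := hpn u hu.2
      have n2 := hwn u hu.2
      have e1 : det2 u w = det2 u q - det2 v u := by
        simp only [det2]; rw [← a1, ← a2]; ring
      have e2 : det2 w u = det2 v u - det2 u q := by
        simp only [det2]; rw [← a1, ← a2]; ring
      rw [e1] at n1
      rw [e2] at n2
      have e3 : det2 u q = det2 v u := by
        by_contra hne
        rcases lt_or_gt_of_ne hne with h' | h'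
        · exact n2 ⟨by linarith, u2⟩
        · exact n1 ⟨u1, by linarith⟩
      -- `u` is a multiple of `w`, and unimodularity at `u` forces `u = w`
      have hu0 : det2 u w = 0 := by rw [e1, e3, sub_self]
      obtain ⟨-, hu3, -⟩ := h u hu.2
      have f1 : u.1 = det2 v u * w.1 := by
        simp only [det2] at *
        linear_combination (-u.1) * hpw + v.1 * hu0
      have f2 : u.2 = det2 v u * w.2 := by
        simp only [det2] at *
        linear_combination (-u.2) * hpw + v.2 * hu0
      have f3 : det2 v u * det2 w (S u) = 1 := by
        rw [← hu3]
        generalize det2 v u = k at *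
        simp only [det2]
        rw [f1, f2]; ring
      have f4 : det2 v u = 1 := Int.eq_one_of_mul_eq_one_right u1.le f3
      rw [f4, one_mul] at f1 f2
      exact hu.1 (Prod.ext f1 f2)
    · rw [hun v hvp]
      obtain ⟨b1, b2, b3⟩ := h v hv.2
      exact ⟨Finset.mem_erase.2 ⟨fun hh => hvp (hsucc v hv.2 hh), b1⟩, b2,
        fun u hu => b3 u (Finset.mem_of_mem_erase hu)⟩
  · have hpe : p ∈ D.erase w := Finset.mem_erase.2 ⟨hne_pw, hp⟩
    have hppe' : pp ∈ (D.erase w).erase p :=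
      Finset.mem_erase.2 ⟨hne_ppp, Finset.mem_erase.2 ⟨hne_ppw, hpp⟩⟩
    rw [← Finset.add_sum_erase D _ hw, ← Finset.add_sum_erase _ _ hpe,
      ← Finset.add_sum_erase _ _ hppe', ← Finset.add_sum_erase (D.erase w) _ hpe,
      ← Finset.add_sum_erase ((D.erase w).erase p) _ hppe']
    have hrest : ∑ v ∈ ((D.erase w).erase p).erase pp, det2 v (S (S v)) =
        ∑ v ∈ ((D.erase w).erase p).erase pp,
          det2 v (Function.update S p q (Function.update S p q v)) := by
      refine Finset.sum_congr rfl fun v hv => ?_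
      simp only [Finset.mem_erase] at hv
      rw [hun v hv.2.1, hun (S v) (fun hh => hv.1 (hpred v hv.2.2.2 hh))]
    rw [hrest, hup, hun q hne_pq.symm, hun pp hne_ppp, hppe, hup, hwdef, hqdef, hb]
    have e1 : det2 w (S q) = det2 p (S q) + det2 q (S q) := by
      simp only [det2]; rw [← a1, ← a2]; ring
    have e2 : det2 pp w = det2 pp p + det2 pp q := by
      simp only [det2]; rw [← a1, ← a2]; ring
    rw [e1, e2, hqq, hppd]; ring

theorem eq_of_mem_of_card_four {α : Type*} [DecidableEq α] {D : Finset α} (hc : D.card = 4)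
    {a b c d : α} (ha : a ∈ D) (hb : b ∈ D) (hc' : c ∈ D) (hd : d ∈ D) (hab : a ≠ b)
    (hac : a ≠ c) (had : a ≠ d) (hbc : b ≠ c) (hbd : b ≠ d) (hcd : c ≠ d) {x : α} (hx : x ∈ D) :
    x = a ∨ x = b ∨ x = c ∨ x = d := by
  have hsub : ({a, b, c, d} : Finset α) = D := by
    apply Finset.eq_of_subset_of_card_le
    · intro y hy
      simp only [Finset.mem_insert, Finset.mem_singleton] at hy
      rcases hy with rfl | rfl | rfl | rfl <;> assumption
    · simp [hc, hab, hac, had, hbc, hbd, hcd]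
  simpa [← hsub] using hx

theorem sum_of_card_four (h : IsFan D S) (hc : D.card = 4) :
    ∑ v ∈ D, det2 v (S (S v)) = 0 := by
  have self (a : ℤ × ℤ) : det2 a a = 0 := by simp [det2, mul_comm]
  have anti (a b : ℤ × ℤ) : det2 a b = - det2 b a := by simp only [det2]; ring
  have mem : ∀ v ∈ D, S v ∈ D := fun v hv => (h v hv).1
  have ne1 : ∀ v ∈ D, S v ≠ v := by
    intro v hv he
    have := (h v hv).2.1
    simp [he, self] at this
  have ne2 : ∀ v ∈ D, S (S v) ≠ v := by
    intro v hv he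
    have h1 := (h v hv).2.1
    have h2 := (h _ (mem v hv)).2.1
    rw [he, anti, h1] at h2
    omega
  have ne3 : ∀ v ∈ D, S (S (S v)) ≠ v := by
    intro v hv he
    have hcard : ({v, S v, S (S v)} : Finset (ℤ × ℤ)).card < D.card := by
      rw [hc]; exact lt_of_le_of_lt Finset.card_le_three (by norm_num)
    obtain ⟨z, hz, hz'⟩ := Finset.exists_mem_notMem_of_card_lt_card hcard
    simp only [Finset.mem_insert, Finset.mem_singleton, not_or] at hz'
    have hSz := mem z hz
    rcases eq_of_mem_of_card_four hc hv (mem _ hv) (mem _ (mem _ hv)) hz (ne1 v hv).symm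
      (ne2 v hv).symm (Ne.symm hz'.1) (ne1 _ (mem v hv)).symm (Ne.symm hz'.2.1) (Ne.symm hz'.2.2)
      hSz with h1 | h1 | h1 | h1
    · rw [← he] at h1
      exact hz'.2.2 (h.injOn hz (mem _ (mem _ hv)) h1)
    · exact hz'.1 (h.injOn hz hv h1)
    · exact hz'.2.1 (h.injOn hz (mem _ hv) h1)
    · exact ne1 z hz h1
  have four : ∀ v ∈ D, S (S (S (S v))) = v := by
    intro v hv
    have hv1 := mem v hv
    have hv2 := mem _ hv1
    have hv3 := mem _ hv2
    rcases eq_of_mem_of_card_four hc hv hv1 hv2 hv3 (ne1 v hv).symm (ne2 v hv).symm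
      (ne3 v hv).symm (ne1 _ hv1).symm (ne2 _ hv1).symm (ne1 _ hv2).symm (mem _ hv3)
      with h1 | h1 | h1 | h1
    · exact h1
    · exact absurd (h.injOn hv3 hv h1) (ne3 v hv)
    · exact absurd (h.injOn hv3 hv1 h1) (ne2 _ hv1)
    · exact absurd h1 (ne1 _ hv3)
  have key : ∑ v ∈ D, det2 v (S (S v)) = ∑ v ∈ D, det2 (S (S v)) (S (S (S (S v)))) := by
    symm
    refine Finset.sum_bij (fun v _ => S (S v)) (fun v hv => mem _ (mem _ hv)) ?_ ?_ ?_
    · intro a ha b hb hab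
      exact h.injOn ha hb (h.injOn (mem _ ha) (mem _ hb) hab)
    · intro b hb
      exact ⟨S (S b), mem _ (mem _ hb), four b hb⟩
    · intro a _; rfl
  have key2 : ∑ v ∈ D, det2 (S (S v)) (S (S (S (S v)))) = - ∑ v ∈ D, det2 v (S (S v)) := by
    rw [← Finset.sum_neg_distrib]
    refine Finset.sum_congr rfl fun v hv => ?_
    rw [four v hv, anti]
  linarith

/-- Heights of consecutive rays over a ray `e` of the fan: if `M ≥ 2` is the largest absolute
height, a ray of height `M` is the sum of its neighbours or its neighbours are opposite. -/
theorem sum_neighbours_of_max_height (h : IsFan D S) {e p : ℤ × ℤ} (he : e ∈ D) (hp : p ∈ D)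
    (hmax : ∀ v ∈ D, |det2 e v| ≤ |det2 e (S p)|) (h2 : 2 ≤ |det2 e (S p)|) :
    det2 p (S (S p)) = 1 ∨ (det2 p (S (S p)) = 0 ∧ -e ∉ D) := by
  obtain ⟨hw, hpw, hpn⟩ := h p hp
  obtain ⟨hq, hwq, hwn⟩ := h _ hw
  obtain ⟨a1, a2⟩ := add_succ hpw hwq
  have m1 := hmax p hp
  have m2 := hmax _ hq
  have n1 := hpn e he
  have n2 := hwn e he
  have n3 := hpn (-e)
  have n4 := hwn (-e)
  generalize S p = w at *
  generalize S w = q at *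
  have hb : det2 e p + det2 e q = det2 p q * det2 e w := by
    simp only [det2] at *
    linear_combination e.1 * a2 - e.2 * a1
  have hprim := (h e he).2.1
  -- `e` is primitive, so the height of `w` does not divide the heights of its neighbours
  have ndvd (a : ℤ × ℤ) (ha : det2 a w = 1 ∨ det2 a w = -1) : ¬ det2 e w ∣ det2 e a := by
    rintro ⟨k, hk⟩
    have : det2 e w ∣ 1 := by
      rcases ha with ha | ha
      · refine ⟨det2 a (S e) - k * det2 w (S e), ?_⟩
        rw [← hprim]
        simp only [det2] at *
        linear_combination -(e.1 * (S e).2 - e.2 * (S e).1) * ha -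
          (w.1 * (S e).2 - w.2 * (S e).1) * hk
      · refine ⟨-(det2 a (S e) - k * det2 w (S e)), ?_⟩
        rw [← hprim]
        simp only [det2] at *
        linear_combination (e.1 * (S e).2 - e.2 * (S e).1) * ha +
          (w.1 * (S e).2 - w.2 * (S e).1) * hk
    have := Int.le_of_dvd one_pos ((abs_dvd _ _).2 this)
    omega
  have d1 := ndvd p (Or.inl hpw)
  have d2 := ndvd q (Or.inr (by rw [← hwq]; simp only [det2]; ring))
  have t1 : det2 p e = - det2 e p := by simp only [det2]; ring
  have t2 : det2 w e = - det2 e w := by simp only [det2]; ring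
  have t3 : det2 p (-e) = det2 e p := by simp [det2]; ring
  have t4 : det2 (-e) w = - det2 e w := by simp [det2]; ring
  have t5 : det2 w (-e) = det2 e w := by simp [det2]; ring
  have t6 : det2 (-e) q = - det2 e q := by simp [det2]; ring
  rw [t1] at n1
  rw [t2] at n2
  rw [t3, t4] at n3
  rw [t5, t6] at n4
  generalize det2 p q = b at *
  generalize det2 e p = yp at *
  generalize det2 e q = yq at *
  generalize det2 e w = y at *
  have p0 : yp ≠ 0 := by rintro rfl; exact d1 (dvd_zero _)
  have q0 : yq ≠ 0 := by rintro rfl; exact d2 (dvd_zero _)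
  have p1 : yp ≠ y := by rintro rfl; exact d1 dvd_rfl
  have q1 : yq ≠ y := by rintro rfl; exact d2 dvd_rfl
  have p2 : yp ≠ -y := by rintro rfl; exact d1 (by simp)
  have q2 : yq ≠ -y := by rintro rfl; exact d2 (by simp)
  rw [abs_le] at m1 m2
  have hb2 : |b| < 2 := by
    have : |b| * |y| < 2 * |y| := by
      rw [← abs_mul, ← hb, abs_lt]
      rcases abs_cases y with ⟨hy, _⟩ | ⟨hy, _⟩ <;> constructor <;> omega
    exact lt_of_mul_lt_mul_right this (abs_nonneg _)
  rw [abs_lt] at hb2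
  obtain rfl | rfl | rfl : b = -1 ∨ b = 0 ∨ b = 1 := by omega
  · exfalso
    rcases abs_cases y with ⟨hy, _⟩ | ⟨hy, _⟩ <;> omega
  · refine Or.inr ⟨rfl, fun hm => ?_⟩
    have n3 := n3 hm
    have n4 := n4 hm
    rcases abs_cases y with ⟨hy, _⟩ | ⟨hy, _⟩ <;> omega
  · exact Or.inl rfl

/-- If all heights over `e` are at most one and two rays have height one, the successor of `e`
is the sum of its neighbours. -/
theorem sum_neighbours_of_height_one (h : IsFan D S) {e v : ℤ × ℤ} (he : e ∈ D)
    (hmax : ∀ v ∈ D, |det2 e v| ≤ 1) (hv : v ∈ D) (hv1 : det2 e v = 1) (hne : v ≠ S e) :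
    det2 e (S (S e)) = 1 := by
  obtain ⟨hw, hew, hen⟩ := h e he
  obtain ⟨hq, hwq, hwn⟩ := h _ hw
  have m := hmax _ hq
  have n1 := hen v hv
  have n2 := hwn v hv
  generalize S e = w at *
  generalize S w = q at *
  have f1 : v.1 = w.1 + det2 v w * e.1 := by
    simp only [det2] at *; linear_combination -v.1 * hew + w.1 * hv1
  have f2 : v.2 = w.2 + det2 v w * e.2 := by
    simp only [det2] at *; linear_combination -v.2 * hew + w.2 * hv1
  have hk : det2 v w ≠ 0 := fun h0 => hne (by ext <;> simp [f1, f2, h0])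
  have e1 : det2 v q = 1 + det2 v w * det2 e q := by
    rw [← hwq]; generalize det2 v w = k at *; simp only [det2]; rw [f1, f2]; ring
  have e2 : det2 w v = - det2 v w := by simp only [det2]; ring
  rw [e1, e2] at n2
  rw [hv1] at n1
  rw [abs_le] at m
  by_contra hcon
  have hk' : det2 v w < 0 := by
    by_contra h'; exact n1 ⟨one_pos, by omega⟩
  have : 0 ≤ det2 v w * det2 e q := mul_nonneg_of_nonpos_of_nonpos hk'.le (by omega)
  exact n2 ⟨by omega, by omega⟩

/-- If all heights over `e` are at most one and two rays have height minus one, the predecessor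
of `e` is the sum of its neighbours. -/
theorem sum_neighbours_of_height_neg_one (h : IsFan D S) {p v : ℤ × ℤ} (hp : p ∈ D)
    (hmax : ∀ v ∈ D, |det2 (S (S p)) v| ≤ 1) (hv : v ∈ D) (hv1 : det2 (S (S p)) v = -1)
    (hne : v ≠ S p) : det2 p (S (S p)) = 1 := by
  obtain ⟨hw, hpw, hpn⟩ := h p hp
  obtain ⟨he, hwe, hwn⟩ := h _ hw
  have m := hmax _ hp
  have n1 := hpn v hv
  have n2 := hwn v hv
  generalize S p = w at *
  generalize S w = e at *
  have f1 : v.1 = w.1 + det2 w v * e.1 := by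
    simp only [det2] at *; linear_combination -v.1 * hwe - w.1 * hv1
  have f2 : v.2 = w.2 + det2 w v * e.2 := by
    simp only [det2] at *; linear_combination -v.2 * hwe - w.2 * hv1
  have hk : det2 w v ≠ 0 := fun h0 => hne (by ext <;> simp [f1, f2, h0])
  have e1 : det2 p v = 1 + det2 w v * det2 p e := by
    rw [← hpw]; generalize det2 w v = k at *; simp only [det2]; rw [f1, f2]; ring
  have e2 : det2 v w = - det2 w v := by simp only [det2]; ring
  have e3 : det2 e p = - det2 p e := by simp only [det2]; ring
  have e4 : det2 v e = - det2 e v := by simp only [det2]; ring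
  rw [e1, e2] at n1
  rw [e4, hv1] at n2
  rw [e3, abs_neg, abs_le] at m
  by_contra hcon
  have hk' : det2 w v < 0 := by
    by_contra h'; exact n2 ⟨by omega, by norm_num⟩
  have : 0 ≤ det2 w v * det2 p e := mul_nonneg_of_nonpos_of_nonpos hk'.le (by omega)
  exact n1 ⟨by omega, by omega⟩

theorem eq_or_eq_neg_of_det_eq_zero {a b a' b' : ℤ × ℤ} (ha : det2 a a' = 1)
    (hb : det2 b b' = 1) (h : det2 a b = 0) : b = a ∨ b = -a := by
  have f1 : b.1 = det2 b a' * a.1 := by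
    simp only [det2] at *; linear_combination -b.1 * ha + a'.1 * h
  have f2 : b.2 = det2 b a' * a.2 := by
    simp only [det2] at *; linear_combination -b.2 * ha + a'.2 * h
  have hk : det2 b a' * det2 a b' = 1 := by
    rw [← hb]; generalize det2 b a' = k at *; simp only [det2]; rw [f1, f2]; ring
  rcases Int.eq_one_or_neg_one_of_mul_eq_one hk with h1 | h1 <;> rw [h1] at f1 f2
  · left; ext <;> simp [f1, f2]
  · right; ext <;> simp [f1, f2]

theorem exists_det_eq_one_of_height_le_one (h : IsFan D S) (hc : 5 ≤ D.card) {e : ℤ × ℤ}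
    (he : e ∈ D) (hmax : ∀ v ∈ D, |det2 e v| ≤ 1) : ∃ p ∈ D, det2 p (S (S p)) = 1 := by
  obtain ⟨w, hw, hwe⟩ := h.exists_pred he
  obtain ⟨p, hp, rfl⟩ := h.exists_pred hw
  by_contra! hcon
  have hsub : D ⊆ {e, -e, S e, S p} := by
    intro v hv
    simp only [Finset.mem_insert, Finset.mem_singleton]
    have m := abs_le.1 (hmax v hv)
    obtain h1 | h1 | h1 : det2 e v = 0 ∨ det2 e v = 1 ∨ det2 e v = -1 := by omega
    · have := eq_or_eq_neg_of_det_eq_zero (h e he).2.1 (h v hv).2.1 h1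
      tauto
    · by_contra! hne
      exact hcon e he (h.sum_neighbours_of_height_one he hmax hv h1 hne.2.2.1)
    · by_contra! hne
      exact hcon p hp (h.sum_neighbours_of_height_neg_one hp (hwe ▸ hmax) hv (hwe ▸ h1) hne.2.2.2)
  have := (Finset.card_le_card hsub).trans Finset.card_le_four
  omega

theorem exists_det_eq_one (h : IsFan D S) (hc : 5 ≤ D.card) :
    ∃ p ∈ D, det2 p (S (S p)) = 1 := by
  obtain ⟨e, he, hopp⟩ : ∃ e ∈ D, (∃ p ∈ D, -p ∈ D) → -e ∈ D := by
    by_cases hex : ∃ p ∈ D, -p ∈ D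
    · obtain ⟨p, hp, hp'⟩ := hex
      exact ⟨p, hp, fun _ => hp'⟩
    · obtain ⟨e, he⟩ : D.Nonempty := Finset.card_pos.1 (by omega)
      exact ⟨e, he, fun h' => absurd h' hex⟩
  obtain ⟨w, hw, hmax⟩ := Finset.exists_max_image D (fun v => |det2 e v|) ⟨e, he⟩
  obtain ⟨p, hp, rfl⟩ := h.exists_pred hw
  rcases le_or_gt 2 |det2 e (S p)| with h2 | h2
  · rcases h.sum_neighbours_of_max_height he hp hmax h2 with h1 | ⟨h0, hne⟩
    · exact ⟨p, hp, h1⟩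
    · refine absurd (hopp ⟨p, hp, ?_⟩) hne
      obtain ⟨a1, a2⟩ := add_succ (h p hp).2.1 (h _ hw).2.1
      rw [h0, zero_mul] at a1 a2
      have : -p = S (S p) := by ext <;> simp <;> omega
      rw [this]
      exact (h _ hw).1
  · exact h.exists_det_eq_one_of_height_le_one hc he fun v hv => (hmax v hv).trans (by omega)

theorem sum_det (h : IsFan D S) (hc : 4 ≤ D.card) :
    ∑ v ∈ D, det2 v (S (S v)) = 3 * D.card - 12 := by
  induction hn : D.card using Nat.strong_induction_on generalizing D S with
  | _ n ih =>
    subst hn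
    rcases hc.eq_or_lt with hc | hc
    · rw [h.sum_of_card_four hc.symm, ← hc]; norm_num
    · obtain ⟨p, hp, hb⟩ := h.exists_det_eq_one hc
      obtain ⟨h1, h2⟩ := h.contract hp hb
      have hcard := Finset.card_erase_add_one (h p hp).1
      rw [h2, ih _ (by omega) h1 (by omega) rfl, ← hcard]
      push_cast; ring

end IsFan

/-- The standard pairing of integer vectors. -/
def dot (u z : ℤ × ℤ) : ℤ := u.1 * z.1 + u.2 * z.2

/-- The pairing with an integer vector as a linear functional on the plane. -/
def dotR (u : ℤ × ℤ) : (ℝ × ℝ) →L[ℝ] ℝ :=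
  (u.1 : ℝ) • ContinuousLinearMap.fst ℝ ℝ ℝ + (u.2 : ℝ) • ContinuousLinearMap.snd ℝ ℝ ℝ

/-- The counterclockwise rotation by a quarter turn. -/
def rot (u : ℤ × ℤ) : ℤ × ℤ := (-u.2, u.1)

theorem dotR_apply (u : ℤ × ℤ) (x : ℝ × ℝ) : dotR u x = u.1 * x.1 + u.2 * x.2 := by
  simp [dotR]

theorem dotR_toR2 (u z : ℤ × ℤ) : dotR u (toR2 z) = (dot u z : ℝ) := by
  simp [dotR_apply, toR2, dot]

theorem toR2_injective : Function.Injective toR2 := by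
  intro a b h
  simp only [toR2, Prod.mk.injEq, Int.cast_inj] at h
  exact Prod.ext h.1 h.2

theorem dot_self_pos {u : ℤ × ℤ} (hu : u ≠ 0) : 0 < dot u u := by
  have : u.1 ≠ 0 ∨ u.2 ≠ 0 := by
    by_contra! h0
    exact hu (Prod.ext h0.1 h0.2)
  simp only [dot]
  rcases this with h1 | h1
  · nlinarith [mul_self_pos.2 h1, mul_self_nonneg u.2]
  · nlinarith [mul_self_pos.2 h1, mul_self_nonneg u.1]

theorem dotR_le_of_mem_convexHull {A : Set (ℤ × ℤ)} {u : ℤ × ℤ} {c : ℤ}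
    (h : ∀ z ∈ A, dot u z ≤ c) {x : ℝ × ℝ} (hx : x ∈ convexHull ℝ (toR2 '' A)) :
    dotR u x ≤ c := by
  have hsub : convexHull ℝ (toR2 '' A) ⊆ {x | dotR u x ≤ c} := by
    refine convexHull_min ?_ (convex_halfSpace_le (dotR u).isLinear _)
    rintro _ ⟨z, hz, rfl⟩
    rw [Set.mem_ofPred_eq, dotR_toR2]
    exact_mod_cast h z hz
  exact hsub hx

theorem exists_dot_lt_of_mem_interior {A : Set (ℤ × ℤ)} {u x : ℤ × ℤ} (hu : u ≠ 0)
    (hx : toR2 x ∈ interior (convexHull ℝ (toR2 '' A))) : ∃ z ∈ A, dot u x < dot u z := by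
  by_contra! h
  have hc : Continuous fun t : ℝ => toR2 x + t • toR2 u := by fun_prop
  have hnhds : ∀ᶠ t in nhds (0 : ℝ), toR2 x + t • toR2 u ∈ interior (convexHull ℝ (toR2 '' A)) :=
    hc.continuousAt.eventually_mem (by simpa using isOpen_interior.mem_nhds hx)
  obtain ⟨t, ht, ht0⟩ := ((hnhds.filter_mono nhdsWithin_le_nhds).and
    (self_mem_nhdsWithin : Set.Ioi (0 : ℝ) ∈ nhdsWithin 0 (Set.Ioi 0))).exists
  have hle := dotR_le_of_mem_convexHull h (interior_subset ht)
  rw [map_add, map_smul, dotR_toR2, dotR_toR2, smul_eq_mul] at hle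
  have : (0 : ℝ) < t * (dot u u : ℝ) := mul_pos ht0 (by exact_mod_cast dot_self_pos hu)
  linarith

variable {Δ : Set (ℝ × ℝ)}

namespace IsLatticePolytope

theorem convex (h : IsLatticePolytope Δ) : Convex ℝ Δ := by
  obtain ⟨S, rfl⟩ := h
  exact convex_convexHull ℝ _

theorem isCompact (h : IsLatticePolytope Δ) : IsCompact Δ := by
  obtain ⟨S, rfl⟩ := h
  exact (S.finite_toSet.image _).isCompact_convexHull ℝ

theorem eq_convexHull (h : IsLatticePolytope Δ) : Δ = convexHull ℝ (toR2 '' latticePts Δ) := by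
  refine Set.Subset.antisymm ?_ (convexHull_min ?_ h.convex)
  · obtain ⟨S, hS⟩ := h
    conv_lhs => rw [hS]
    refine convexHull_mono (Set.image_mono fun z hz => ?_)
    rw [latticePts, Set.mem_ofPred_eq, hS]
    exact subset_convexHull ℝ _ ⟨z, hz, rfl⟩
  · rintro _ ⟨z, hz, rfl⟩
    exact hz

theorem finite_latticePts (h : IsLatticePolytope Δ) : (latticePts Δ).Finite := by
  obtain ⟨R, hR⟩ := h.isCompact.isBounded.exists_norm_le
  refine (Set.finite_Icc ((-⌈R⌉, -⌈R⌉) : ℤ × ℤ) (⌈R⌉, ⌈R⌉)).subset fun z hz => ?_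
  have h1 := hR _ hz
  rw [toR2, Prod.norm_mk, max_le_iff, Real.norm_eq_abs, Real.norm_eq_abs, abs_le, abs_le] at h1
  have h2 := Int.le_ceil R
  have a1 : (z.1 : ℝ) ≤ ⌈R⌉ := by linarith
  have a2 : (z.2 : ℝ) ≤ ⌈R⌉ := by linarith
  have a3 : -(⌈R⌉ : ℝ) ≤ z.1 := by linarith
  have a4 : -(⌈R⌉ : ℝ) ≤ z.2 := by linarith
  exact ⟨⟨by exact_mod_cast a3, by exact_mod_cast a4⟩, by exact_mod_cast a1, by exact_mod_cast a2⟩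

theorem exists_dot_lt (h : IsLatticePolytope Δ) {u x : ℤ × ℤ} (hu : u ≠ 0)
    (hx : x ∈ intPts Δ) : ∃ z ∈ latticePts Δ, dot u x < dot u z := by
  rw [intPts, Set.mem_ofPred_eq, h.eq_convexHull] at hx
  exact exists_dot_lt_of_mem_interior hu hx

theorem dotR_le (h : IsLatticePolytope Δ) {u : ℤ × ℤ} {c : ℤ}
    (hc : ∀ z ∈ latticePts Δ, dot u z ≤ c) {x : ℝ × ℝ} (hx : x ∈ Δ) : dotR u x ≤ c := by
  rw [h.eq_convexHull] at hx
  exact dotR_le_of_mem_convexHull hc hx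

/-- A point that is not interior is separated from the interior points. -/
theorem exists_separating (h : IsLatticePolytope Δ) {p z : ℤ × ℤ} (hp : p ∈ intPts Δ)
    (hz : z ∉ intPts Δ) : ∃ α β : ℝ, α * p.1 + β * p.2 < α * z.1 + β * z.2 ∧
      ∀ x ∈ Δ, α * x.1 + β * x.2 ≤ α * z.1 + β * z.2 := by
  obtain ⟨f, hf⟩ := geometric_hahn_banach_open_point h.convex.interior isOpen_interior hz
  have hfa : ∀ x : ℝ × ℝ, f x = f (1, 0) * x.1 + f (0, 1) * x.2 := by
    intro x
    have : x = x.1 • ((1, 0) : ℝ × ℝ) + x.2 • ((0, 1) : ℝ × ℝ) := by ext <;> simp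
    conv_lhs => rw [this, map_add, map_smul, map_smul, smul_eq_mul, smul_eq_mul]
    ring
  refine ⟨f (1, 0), f (0, 1), ?_, fun x hx => ?_⟩
  · have := hf _ hp
    rwa [hfa, hfa (toR2 z)] at this
  · have hx' : x ∈ closure (interior Δ) := by
      rw [h.convex.closure_interior_eq_closure_of_nonempty_interior ⟨_, hp⟩]
      exact subset_closure hx
    have hle : f x ≤ f (toR2 z) :=
      closure_minimal (fun y hy => (hf y hy).le) (isClosed_le f.continuous continuous_const) hx'
    rwa [hfa, hfa (toR2 z)] at hle

theorem mem_intPts_of_combo (h : IsLatticePolytope Δ) {p z : ℤ × ℤ} (hp : p ∈ intPts Δ)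
    {y : ℝ × ℝ} (hy : y ∈ Δ) {t : ℝ} (h0 : 0 ≤ t) (h1 : t < 1)
    (e1 : (z.1 : ℝ) = (1 - t) * p.1 + t * y.1) (e2 : (z.2 : ℝ) = (1 - t) * p.2 + t * y.2) :
    z ∈ intPts Δ := by
  have := h.convex.combo_interior_self_mem_interior hp hy (sub_pos.2 h1) h0 (by ring)
  rw [intPts, Set.mem_ofPred_eq]
  convert this using 1
  ext <;> simp [toR2, e1, e2]

theorem combo_mem (h : IsLatticePolytope Δ) {x y : ℝ × ℝ} (hx : x ∈ Δ)
    (hy : y ∈ Δ) {t : ℝ} (h0 : 0 ≤ t) (h1 : t ≤ 1) :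
    ((1 - t) * x.1 + t * y.1, (1 - t) * x.2 + t * y.2) ∈ Δ :=
  h.convex hx hy (sub_nonneg.2 h1) h0 (by ring)

theorem intPts_subset : intPts Δ ⊆ latticePts Δ :=
  Set.preimage_mono interior_subset

end IsLatticePolytope

/-- The nonzero integer vectors `u` whose maximum on `Δ` exceeds the value at some interior
lattice point by at most one. -/
def adjNormals (Δ : Set (ℝ × ℝ)) : Set (ℤ × ℤ) :=
  {u | u ≠ 0 ∧ ∃ p ∈ intPts Δ, ∀ z ∈ latticePts Δ, dot u z ≤ dot u p + 1}

/-- `p` and `q` are the counterclockwise-last points of the faces in direction `w` of the interior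
lattice points and of the lattice points of `Δ`, and the two faces lie at lattice distance one. -/
structure IsCornerPair (Δ : Set (ℝ × ℝ)) (w p q : ℤ × ℤ) : Prop where
  ne_zero : w ≠ 0
  int : p ∈ intPts Δ
  mem : q ∈ latticePts Δ
  height : dot w q = dot w p + 1
  le : ∀ z ∈ latticePts Δ, dot w z ≤ dot w q
  last_int : ∀ z ∈ intPts Δ, dot w z = dot w p → dot (rot w) z ≤ dot (rot w) p
  last : ∀ z ∈ latticePts Δ, dot w z = dot w q → dot (rot w) z ≤ dot (rot w) q

namespace IsLatticePolytope

theorem finite_adjNormals (h : IsLatticePolytope Δ) : (adjNormals Δ).Finite := by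
  have hI : (intPts Δ).Finite := h.finite_latticePts.subset intPts_subset
  have key : ∀ p ∈ intPts Δ,
      {u : ℤ × ℤ | ∀ z ∈ latticePts Δ, dot u z ≤ dot u p + 1}.Finite := by
    intro p hp
    obtain ⟨ε, hε, hball⟩ := Metric.isOpen_iff.1 isOpen_interior _ hp
    have hmem : ∀ a b : ℝ, |a| < ε → |b| < ε → ((p.1 : ℝ) + a, (p.2 : ℝ) + b) ∈ Δ := by
      intro a b ha hb
      refine interior_subset (hball ?_)
      rw [Metric.mem_ball, dist_eq_norm, toR2, Prod.mk_sub_mk, add_sub_cancel_left,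
        add_sub_cancel_left, Prod.norm_mk]
      exact max_lt ha hb
    have h1 : |ε / 2| < ε := by rw [abs_of_pos (half_pos hε)]; exact half_lt_self hε
    have h2 : |-(ε / 2)| < ε := by rwa [abs_neg]
    have h3 : |(0 : ℝ)| < ε := by rwa [abs_zero]
    set N : ℤ := ⌈2 / ε⌉
    have hNε : 2 / ε ≤ N := Int.le_ceil _
    refine (Set.finite_Icc ((-N, -N) : ℤ × ℤ) (N, N)).subset fun u hu => ?_
    have hle : ∀ a b : ℝ, |a| < ε → |b| < ε → u.1 * a + u.2 * b ≤ 1 := by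
      intro a b ha hb
      have := h.dotR_le hu (hmem a b ha hb)
      rw [dotR_apply, dot] at this
      push_cast at this
      linarith
    have hb : ∀ c : ℝ, c * (ε / 2) ≤ 1 → c ≤ N := by
      intro c hc
      refine le_trans ?_ hNε
      rw [le_div_iff₀ hε]
      linarith
    have a1 := hb _ (by simpa using hle _ _ h1 h3)
    have a2 := hb _ (by simpa using hle _ _ h3 h1)
    have a3 := hb (-u.1) (by simpa using hle _ _ h2 h3)
    have a4 := hb (-u.2) (by simpa using hle _ _ h3 h2)
    norm_cast at a1 a2 a3 a4
    exact ⟨⟨neg_le.1 a3, neg_le.1 a4⟩, a1, a2⟩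
  refine (hI.biUnion key).subset ?_
  rintro u ⟨-, p, hp, hu⟩
  exact Set.mem_biUnion hp hu

theorem exists_corner (h : IsLatticePolytope Δ) {w : ℤ × ℤ} (hw : w ∈ adjNormals Δ) :
    ∃ p q, IsCornerPair Δ w p q := by
  obtain ⟨hw0, p₀, hp₀, hle⟩ := hw
  have hI : (intPts Δ).Finite := h.finite_latticePts.subset intPts_subset
  obtain ⟨q₀, hq₀, hlt⟩ := h.exists_dot_lt hw0 hp₀
  have hq₀e : dot w q₀ = dot w p₀ + 1 := le_antisymm (hle _ hq₀) hlt
  obtain ⟨p, ⟨hp, hpe⟩, hpm⟩ := (hI.inter_of_left {z | dot w z = dot w p₀}).exists_maximalFor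
    (dot (rot w)) _ ⟨p₀, hp₀, rfl⟩
  obtain ⟨q, ⟨hq, hqe⟩, hqm⟩ :=
    (h.finite_latticePts.inter_of_left {z | dot w z = dot w q₀}).exists_maximalFor
    (dot (rot w)) _ ⟨q₀, hq₀, rfl⟩
  rw [Set.mem_ofPred_eq] at hpe hqe
  refine ⟨p, q, hw0, hp, hq, by rw [hpe, hqe, hq₀e], fun z hz => ?_, fun z hz hze => ?_,
    fun z hz hze => ?_⟩
  · rw [hqe, hq₀e]
    exact hle z hz
  · by_contra! hc
    exact absurd (hpm ⟨hz, hze.trans hpe⟩ hc.le) (not_le.2 hc)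
  · by_contra! hc
    exact absurd (hqm ⟨hz, hze.trans hqe⟩ hc.le) (not_le.2 hc)

end IsLatticePolytope

namespace IsCornerPair

variable {w p q : ℤ × ℤ}

theorem int_le (hc : IsCornerPair Δ w p q) (h : IsLatticePolytope Δ) {z : ℤ × ℤ}
    (hz : z ∈ intPts Δ) : dot w z ≤ dot w p := by
  obtain ⟨y, hy, hlt⟩ := h.exists_dot_lt hc.ne_zero hz
  have := hc.le y hy
  have := hc.height
  omega

theorem add_rot_notMem (hc : IsCornerPair Δ w p q) : p + rot w ∉ intPts Δ := by
  intro hm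
  have h1 := hc.last_int _ hm (by simp only [dot, rot, Prod.fst_add, Prod.snd_add]; ring)
  have h2 := dot_self_pos hc.ne_zero
  simp only [dot, rot, Prod.fst_add, Prod.snd_add] at h1 h2
  linarith

theorem det_succ (hc : IsCornerPair Δ w p q) : det2 w (w + rot (q - p)) = 1 := by
  have := hc.height
  simp only [dot] at this
  simp only [det2, rot, Prod.fst_add, Prod.snd_add, Prod.fst_sub, Prod.snd_sub]
  linear_combination this

theorem dot_succ_eq (hc : IsCornerPair Δ w p q) :
    dot (w + rot (q - p)) q = dot (w + rot (q - p)) p + 1 := by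
  have := hc.height
  simp only [dot, rot, Prod.fst_add, Prod.snd_add, Prod.fst_sub, Prod.snd_sub] at this ⊢
  linear_combination this

theorem dot_succ_le (hc : IsCornerPair Δ w p q) (h : IsLatticePolytope Δ) {z : ℤ × ℤ}
    (hz : z ∈ latticePts Δ) : dot (w + rot (q - p)) z ≤ dot (w + rot (q - p)) p + 1 := by
  obtain ⟨α, β, hpos, hle⟩ := h.exists_separating hc.int hc.add_rot_notMem
  have hq := hle _ hc.mem
  have hz' := hle _ hz
  have hh := hc.height
  have hwz := hc.le z hz
  obtain ⟨d, rfl⟩ : ∃ d, q = p + d := ⟨q - p, by abel⟩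
  obtain ⟨x, rfl⟩ : ∃ x, z = p + x := ⟨z - p, by abel⟩
  have hlast := hc.last _ hz
  have hn := dot_self_pos hc.ne_zero
  simp only [dot, rot, toR2, Prod.fst_add, Prod.snd_add, Prod.fst_sub, Prod.snd_sub,
    Int.cast_add, Int.cast_neg] at *
  obtain ⟨a, ha⟩ : ∃ a, a = w.1 * x.1 + w.2 * x.2 := ⟨_, rfl⟩
  obtain ⟨c, hcc⟩ : ∃ c, c = d.1 * x.2 - d.2 * x.1 := ⟨_, rfl⟩
  have hd : w.1 * d.1 + w.2 * d.2 = 1 := by linear_combination hh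
  have hx1 : x.1 = a * d.1 - c * w.2 := by rw [ha, hcc]; linear_combination -x.1 * hd
  have hx2 : x.2 = a * d.2 + c * w.1 := by rw [ha, hcc]; linear_combination -x.2 * hd
  have ha1 : a ≤ 1 := by linarith
  suffices hac : a + c ≤ 1 by nlinarith
  rcases ha1.lt_or_eq with hlt | heq
  · have ha0 : a ≤ 0 := by omega
    have ha0' : (a : ℝ) ≤ 0 := by exact_mod_cast ha0
    have hx1' : (x.1 : ℝ) = a * d.1 - c * w.2 := by exact_mod_cast hx1
    have hx2' : (x.2 : ℝ) = a * d.2 + c * w.1 := by exact_mod_cast hx2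
    rw [hx1', hx2'] at hz'
    obtain ⟨e, he⟩ : ∃ e : ℝ, e = β * w.1 - α * w.2 := ⟨_, rfl⟩
    obtain ⟨f, hf⟩ : ∃ f : ℝ, f = α * d.1 + β * d.2 := ⟨_, rfl⟩
    have he0 : 0 < e := by rw [he]; linarith
    have hfe : f ≤ e := by rw [he, hf]; linarith
    have hz'' : a * f + c * e ≤ e := by rw [he, hf]; linarith
    have h1 : (a : ℝ) * e ≤ a * f := mul_le_mul_of_nonpos_left hfe ha0'
    have h2 : ((a : ℝ) + c) * e ≤ 1 * e := by linarith
    exact_mod_cast le_of_mul_le_mul_right h2 he0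
  · have h1 := hlast (by linarith)
    rw [heq] at hx1 hx2
    have h2 : c * (w.1 * w.1 + w.2 * w.2) ≤ 0 := by rw [hx1, hx2] at h1; linarith
    have h3 : c ≤ 0 := by
      by_contra! h4
      exact absurd (mul_pos h4 hn) (not_lt.2 h2)
    omega

theorem succ_mem (hc : IsCornerPair Δ w p q) (h : IsLatticePolytope Δ) :
    w + rot (q - p) ∈ adjNormals Δ := by
  refine ⟨fun h0 => ?_, p, hc.int, fun z hz => hc.dot_succ_le h hz⟩
  have := hc.det_succ
  rw [h0] at this
  simp [det2] at this

theorem not_between (hc : IsCornerPair Δ w p q) (h : IsLatticePolytope Δ) {v : ℤ × ℤ}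
    (hv : v ∈ adjNormals Δ) : ¬(0 < det2 w v ∧ 0 < det2 v (w + rot (q - p))) := by
  rintro ⟨hβ, hα⟩
  obtain ⟨p', q', hc'⟩ := h.exists_corner hv
  have h1 := hc'.le _ hc.mem
  have h2 := hc.int_le h hc'.int
  have h3 := hc'.height
  have h4 : dot (w + rot (q - p)) p' ≤ dot (w + rot (q - p)) p := by
    obtain ⟨y, hy, hlt⟩ := h.exists_dot_lt (hc.succ_mem h).1 hc'.int
    have := hc.dot_succ_le h hy
    omega
  have h5 : dot v p' - dot v p = det2 v (w + rot (q - p)) * (dot w p' - dot w p) +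
      det2 w v * (dot (w + rot (q - p)) p' - dot (w + rot (q - p)) p) := by
    have hd := hc.det_succ
    generalize w + rot (q - p) = w' at *
    simp only [dot, det2] at *
    linear_combination (-(v.1 * (p'.1 - p.1) + v.2 * (p'.2 - p.2))) * hd
  have h6 : dot v p' ≤ dot v p := by nlinarith
  have key : dot v q - dot v p = det2 w v + det2 v (w + rot (q - p)) := by
    simp only [dot, det2, rot, Prod.fst_add, Prod.snd_add, Prod.fst_sub, Prod.snd_sub]
    ring
  omega

end IsCornerPair

namespace IsLatticePolytope

theorem exists_isFan (h : IsLatticePolytope Δ) : ∃ (D : Finset (ℤ × ℤ)) (S P Q : ℤ × ℤ → ℤ × ℤ),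
    (D : Set (ℤ × ℤ)) = adjNormals Δ ∧ IsFan D S ∧ ∀ w ∈ D, IsCornerPair Δ w (P w) (Q w) ∧
      S w = w + rot (Q w - P w) := by
  have hex : ∀ w : ℤ × ℤ, ∃ pq : (ℤ × ℤ) × (ℤ × ℤ),
      w ∈ adjNormals Δ → IsCornerPair Δ w pq.1 pq.2 := by
    intro w
    by_cases hw : w ∈ adjNormals Δ
    · obtain ⟨p, q, hc⟩ := h.exists_corner hw
      exact ⟨(p, q), fun _ => hc⟩
    · exact ⟨0, fun h' => absurd h' hw⟩
  choose C hC using hex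
  have hD : ∀ {w}, w ∈ h.finite_adjNormals.toFinset → w ∈ adjNormals Δ :=
    fun {w} hw => h.finite_adjNormals.mem_toFinset.1 hw
  refine ⟨h.finite_adjNormals.toFinset, fun w => w + rot ((C w).2 - (C w).1), fun w => (C w).1,
    fun w => (C w).2, h.finite_adjNormals.coe_toFinset, fun w hw => ?_,
    fun w hw => ⟨hC w (hD hw), rfl⟩⟩
  have hc := hC w (hD hw)
  exact ⟨h.finite_adjNormals.mem_toFinset.2 (hc.succ_mem h), hc.det_succ,
    fun v hv => hc.not_between h (hD hv)⟩

end IsLatticePolytope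

/-- The faces of `Δ` and of its interior lattice points in direction `u` are at lattice distance
one; they start at `q` and `p` and have lattice lengths `L` and `l`. -/
structure IsStrip (Δ : Set (ℝ × ℝ)) (u p q : ℤ × ℤ) (l L : ℕ) : Prop where
  height : dot u q = dot u p + 1
  int : p ∈ intPts Δ
  int_end : p + (l : ℤ) • rot u ∈ intPts Δ
  mem : q ∈ latticePts Δ
  mem_end : q + (L : ℤ) • rot u ∈ latticePts Δ
  le : ∀ z ∈ latticePts Δ, dot u z ≤ dot u q
  int_range : ∀ z ∈ intPts Δ, dot u z = dot u p → ∃ i : ℕ, i ≤ l ∧ z = p + (i : ℤ) • rot u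
  range : ∀ z ∈ latticePts Δ, dot u z = dot u q → ∃ i : ℕ, i ≤ L ∧ z = q + (i : ℤ) • rot u

theorem eq_add_smul_rot {w u z p : ℤ × ℤ} (hd : det2 w u = 1) (h : dot u z = dot u p) :
    z = p + (dot w p - dot w z) • rot u := by
  simp only [det2, dot] at *
  ext
  · simp only [rot, Prod.fst_add, Prod.smul_fst, smul_eq_mul]
    linear_combination -w.2 * h - (z.1 - p.1) * hd
  · simp only [rot, Prod.snd_add, Prod.smul_snd, smul_eq_mul]
    linear_combination w.1 * h - (z.2 - p.2) * hd

theorem dot_add (u a b : ℤ × ℤ) : dot u (a + b) = dot u a + dot u b := by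
  simp only [dot, Prod.fst_add, Prod.snd_add]
  ring

theorem dot_smul (u a : ℤ × ℤ) (c : ℤ) : dot u (c • a) = c * dot u a := by
  simp only [dot, Prod.smul_fst, Prod.smul_snd, smul_eq_mul]
  ring

theorem dot_rot (u v : ℤ × ℤ) : dot u (rot v) = det2 v u := by
  simp only [dot, rot, det2]
  ring

theorem dot_rot_rot (u : ℤ × ℤ) : dot (rot u) (rot u) = dot u u := by
  simp only [dot, rot]
  ring

theorem det2_self (u : ℤ × ℤ) : det2 u u = 0 := by
  simp only [det2]
  ring

theorem smul_rot_left_cancel {u a : ℤ × ℤ} (hu : u ≠ 0) {i j : ℤ}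
    (h : a + i • rot u = a + j • rot u) : i = j := by
  have h1 := congrArg (dot (rot u)) h
  rw [dot_add, dot_add, dot_smul, dot_smul, dot_rot_rot] at h1
  exact mul_right_cancel₀ (dot_self_pos hu).ne' (add_left_cancel h1)

namespace IsCornerPair

variable {w p q p' q' : ℤ × ℤ}

/-- Consecutive corners bound a strip. -/
theorem exists_isStrip (h : IsLatticePolytope Δ) (hw : IsCornerPair Δ w p q)
    {u : ℤ × ℤ} (hu : u = w + rot (q - p)) (hc : IsCornerPair Δ u p' q') :
    ∃ l L : ℕ, IsStrip Δ u p q l L ∧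
      det2 w (u + rot (q' - p')) = 2 - ((L : ℤ) - l) := by
  have hdet : det2 w u = 1 := hu ▸ hw.det_succ
  have hheight : dot u q = dot u p + 1 := hu ▸ hw.dot_succ_eq
  have hpp : dot u p' = dot u p := by
    obtain ⟨y, hy, hlt⟩ := h.exists_dot_lt hc.ne_zero hc.int
    have h1 : dot u y ≤ dot u p + 1 := hu ▸ hw.dot_succ_le h hy
    have h2 := hc.int_le h hw.int
    omega
  have hqq : dot u q' = dot u q := by rw [hc.height, hpp, hheight]
  have hn := dot_self_pos hc.ne_zero
  obtain ⟨l, hl⟩ := Int.eq_ofNat_of_zero_le (sub_nonneg.2 (hw.int_le h hc.int))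
  obtain ⟨L, hL⟩ := Int.eq_ofNat_of_zero_le (sub_nonneg.2 (hw.le _ hc.mem))
  have hp' := eq_add_smul_rot hdet hpp
  have hq' := eq_add_smul_rot hdet hqq
  rw [hl] at hp'
  rw [hL] at hq'
  refine ⟨l, L, ⟨hheight, hw.int, hp' ▸ hc.int, hw.mem, hq' ▸ hc.mem,
    fun z hz => hqq ▸ hc.le z hz, fun z hz hze => ?_, fun z hz hze => ?_⟩, ?_⟩
  · obtain ⟨i, hi⟩ := Int.eq_ofNat_of_zero_le (sub_nonneg.2 (hw.int_le h hz))
    have hz' := eq_add_smul_rot hdet hze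
    rw [hi] at hz'
    refine ⟨i, ?_, hz'⟩
    have h1 := hc.last_int z hz (hze.trans hpp.symm)
    rw [hz', hp', dot_add, dot_add, dot_smul, dot_smul, dot_rot_rot] at h1
    have h2 : (i : ℤ) ≤ l := le_of_mul_le_mul_right (le_of_add_le_add_left h1) hn
    exact_mod_cast h2
  · obtain ⟨i, hi⟩ := Int.eq_ofNat_of_zero_le (sub_nonneg.2 (hw.le _ hz))
    have hz' := eq_add_smul_rot hdet hze
    rw [hi] at hz'
    refine ⟨i, ?_, hz'⟩
    have h1 := hc.last z hz (hze.trans hqq.symm)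
    rw [hz', hq', dot_add, dot_add, dot_smul, dot_smul, dot_rot_rot] at h1
    have h2 : (i : ℤ) ≤ L := le_of_mul_le_mul_right (le_of_add_le_add_left h1) hn
    exact_mod_cast h2
  · have hu1 : u.1 = w.1 - (q.2 - p.2) := by rw [hu]; simp [rot]; ring
    have hu2 : u.2 = w.2 + (q.1 - p.1) := by rw [hu]; simp [rot]
    rw [hp', hq']
    simp only [det2, rot, Prod.fst_add, Prod.snd_add, Prod.fst_sub, Prod.snd_sub, Prod.smul_fst,
      Prod.smul_snd, smul_eq_mul] at hdet ⊢
    linear_combination (2 - (L - l) : ℤ) * hdet + w.2 * hu1 - w.1 * hu2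

end IsCornerPair

namespace IsStrip

variable {u p q : ℤ × ℤ} {l L : ℕ}

theorem ne_zero (hs : IsStrip Δ u p q l L) : u ≠ 0 := by
  rintro rfl
  have := hs.height
  simp [dot] at this

theorem det_rot (hs : IsStrip Δ u p q l L) : det2 u (rot (q - p)) = 1 := by
  have := hs.height
  simp only [dot] at this
  simp only [det2, rot, Prod.fst_sub, Prod.snd_sub]
  linear_combination this

theorem segment_mem (hs : IsStrip Δ u p q l L) (h : IsLatticePolytope Δ) {t : ℝ} (h0 : 0 ≤ t)
    (h1 : t ≤ L) : ((q.1 : ℝ) + t * (-u.2), (q.2 : ℝ) + t * u.1) ∈ Δ := by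
  rcases h0.eq_or_lt with rfl | h0
  · simpa [toR2] using (show toR2 q ∈ Δ from hs.mem)
  · have hL : (0 : ℝ) < L := h0.trans_le h1
    have := h.combo_mem hs.mem hs.mem_end (div_nonneg h0.le hL.le) ((div_le_one hL).2 h1)
    convert this using 2
    · simp [toR2, rot]
      field_simp
      ring
    · simp [toR2, rot]
      field_simp
      ring

/-- A point of the line through the interior face which lies strictly beyond a lattice point
of this line makes that lattice point interior. -/
theorem add_smul_rot_mem_int (hs : IsStrip Δ u p q l L) (h : IsLatticePolytope Δ) {s : ℝ} {i : ℤ}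
    (hs' : ((p.1 : ℝ) + s * (-u.2), (p.2 : ℝ) + s * u.1) ∈ Δ) (hs0 : s ≠ 0)
    (h0 : 0 ≤ i / s) (h1 : i / s < 1) : p + i • rot u ∈ intPts Δ := by
  refine h.mem_intPts_of_combo hs.int hs' h0 h1 ?_ ?_
  · simp [rot]
    field_simp
    ring
  · simp [rot]
    field_simp
    ring

theorem add_mem (hs : IsStrip Δ u p q l L) (h : IsLatticePolytope Δ) {j : ℕ} (hj : 1 ≤ j)
    (hjl : j + l + 1 ≤ L) {z : ℤ × ℤ} (hz : z ∈ latticePts Δ) (hzq : dot u z ≠ dot u q) :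
    z + (q - p + (j : ℤ) • rot u) ∈ latticePts Δ := by
  have hh := hs.height
  have hle := hs.le z hz
  obtain ⟨k, hk⟩ := Int.eq_ofNat_of_zero_le (show 0 ≤ dot u p - dot u z by omega)
  obtain ⟨c, hc⟩ : ∃ c, c = det2 (q - p) (z - p) := ⟨_, rfl⟩
  have hz1 : z.1 = p.1 - k * (q.1 - p.1) - c * u.2 := by
    simp only [dot, det2, Prod.fst_sub, Prod.snd_sub] at *
    rw [hc]
    linear_combination -(q.1 - p.1) * hk - (z.1 - p.1) * hh
  have hz2 : z.2 = p.2 - k * (q.2 - p.2) + c * u.1 := by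
    simp only [dot, det2, Prod.fst_sub, Prod.snd_sub] at *
    rw [hc]
    linear_combination -(q.2 - p.2) * hk - (z.2 - p.2) * hh
  have hz1' : (z.1 : ℝ) = p.1 - k * (q.1 - p.1) - c * u.2 := by exact_mod_cast hz1
  have hz2' : (z.2 : ℝ) = p.2 - k * (q.2 - p.2) + c * u.1 := by exact_mod_cast hz2
  have hk1 : (0 : ℝ) < (k : ℝ) + 1 := by positivity
  have hk0 : (0 : ℝ) ≤ (k : ℝ) / (k + 1) := by positivity
  have hk2 : (k : ℝ) / (k + 1) ≤ 1 := by rw [div_le_one hk1]; linarith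
  have hup : c + (k + 1) * j ≤ L := by
    by_contra! hlt
    have hmem := h.combo_mem hz (hs.segment_mem h (Nat.cast_nonneg L) le_rfl) hk0 hk2
    set s : ℝ := (c + k * L) / (k + 1) with hsdef
    have hsl : (l : ℝ) + 1 < s := by
      rw [hsdef, lt_div_iff₀ hk1]
      have h1 : (L : ℝ) + 1 ≤ c + (k + 1) * j := by exact_mod_cast hlt
      have h2 : (j : ℝ) + l + 1 ≤ L := by exact_mod_cast hjl
      nlinarith
    have hs0 : 0 < s := by
      have : (0 : ℝ) ≤ l := Nat.cast_nonneg l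
      linarith
    have hin : p + ((l : ℤ) + 1) • rot u ∈ intPts Δ := by
      refine hs.add_smul_rot_mem_int h (s := s) ?_ hs0.ne' ?_ ?_
      · convert hmem using 2
        · simp only [toR2, hz1', hsdef]
          field_simp
          ring
        · simp only [toR2, hz2', hsdef]
          field_simp
          ring
      · push_cast
        positivity
      · rw [div_lt_one hs0]
        push_cast
        exact hsl
    obtain ⟨i, hi, he⟩ := hs.int_range _ hin (by rw [dot_add, dot_smul, dot_rot, det2_self]; ring)
    have := smul_rot_left_cancel hs.ne_zero he
    omega
  have hlow : 0 ≤ c + (k + 1) * j := by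
    by_contra! hlt
    have hmem := h.combo_mem hz hs.mem hk0 hk2
    set s : ℝ := c / (k + 1) with hsdef
    have hsl : s < -1 := by
      rw [hsdef, div_lt_iff₀ hk1]
      have h1 : (c : ℝ) + (k + 1) * j + 1 ≤ 0 := by exact_mod_cast hlt
      have h2 : (1 : ℝ) ≤ j := by exact_mod_cast hj
      nlinarith
    have hs0 : s < 0 := by linarith
    have hin : p + (-1 : ℤ) • rot u ∈ intPts Δ := by
      refine hs.add_smul_rot_mem_int h (s := s) ?_ hs0.ne ?_ ?_
      · convert hmem using 2
        · simp only [toR2, hz1', hsdef]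
          field_simp
          ring
        · simp only [toR2, hz2', hsdef]
          field_simp
          ring
      · push_cast
        exact div_nonneg_of_nonpos (by norm_num) hs0.le
      · rw [div_lt_one_of_neg hs0]
        push_cast
        exact hsl
    obtain ⟨i, hi, he⟩ := hs.int_range _ hin (by rw [dot_add, dot_smul, dot_rot, det2_self]; ring)
    have := smul_rot_left_cancel hs.ne_zero he
    omega
  have hlow' : (0 : ℝ) ≤ c + (k + 1) * j := by exact_mod_cast hlow
  have hup' : (c : ℝ) + (k + 1) * j ≤ L := by exact_mod_cast hup
  have hmem := h.combo_mem (hs.segment_mem h hlow' hup') hz hk0 hk2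
  rw [latticePts, Set.mem_ofPred_eq]
  convert hmem using 1
  ext
  · simp [toR2, hz1', rot]
    field_simp
    ring
  · simp [toR2, hz2', rot]
    field_simp
    ring

theorem isFacet (hs : IsStrip Δ u p q l L) (h : IsLatticePolytope Δ) (hL : 1 ≤ L) :
    IsFacet Δ {x ∈ Δ | dotR u x = dot u q} := by
  have hmax : ∀ x ∈ Δ, dotR u x ≤ dot u q := fun x hx => h.dotR_le hs.le hx
  refine ⟨fun _ => ⟨dotR u, ?_⟩, ?_, fun hsub => ?_⟩
  · ext x
    refine ⟨fun hx => ⟨hx.1, fun y hy => (hmax y hy).trans hx.2.ge⟩, fun hx => ⟨hx.1, ?_⟩⟩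
    refine le_antisymm (hmax x hx.1) ?_
    rw [← dotR_toR2]
    exact hx.2 _ hs.mem
  · rw [collinear_iff_exists_forall_eq_smul_vadd]
    refine ⟨toR2 q, toR2 (rot u), ?_⟩
    rintro x ⟨-, hx⟩
    rw [dotR_apply, dot] at hx
    have hh := hs.height
    have hh' : (u.1 : ℝ) * q.1 + u.2 * q.2 = u.1 * p.1 + u.2 * p.2 + 1 := by exact_mod_cast hh
    push_cast at hx
    refine ⟨(q.1 - p.1) * (x.2 - q.2) - (q.2 - p.2) * (x.1 - q.1), ?_⟩
    ext
    · simp [toR2, rot]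
      linear_combination (q.1 - p.1 : ℝ) * hx - (x.1 - q.1) * hh'
    · simp [toR2, rot]
      linear_combination (q.2 - p.2 : ℝ) * hx - (x.2 - q.2) * hh'
  · have h1 : toR2 q = toR2 (q + (L : ℤ) • rot u) := by
      refine hsub ⟨hs.mem, dotR_toR2 _ _⟩ ⟨hs.mem_end, ?_⟩
      rw [dotR_toR2, dot_add, dot_smul, dot_rot, det2_self, mul_zero, add_zero]
    have h2 := congrArg (dot (rot u)) (toR2_injective h1)
    rw [dot_add, dot_smul, dot_rot_rot] at h2
    have h3 := mul_pos (show (0 : ℤ) < L by exact_mod_cast hL) (dot_self_pos hs.ne_zero)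
    linarith

theorem dot_column (hs : IsStrip Δ u p q l L) (j : ℤ) : dot u (q - p + j • rot u) = 1 := by
  have hh := hs.height
  rw [dot_add, dot_smul, dot_rot, det2_self]
  simp only [dot, Prod.fst_sub, Prod.snd_sub] at *
  linear_combination hh

theorem isColumnVector (hs : IsStrip Δ u p q l L) (h : IsLatticePolytope Δ) {j : ℕ} (hj : 1 ≤ j)
    (hjl : j + l + 1 ≤ L) : IsColumnVector Δ (q - p + (j : ℤ) • rot u) := by
  refine ⟨fun h0 => ?_, _, hs.isFacet h (by omega), fun z hz => ?_⟩
  · have := hs.dot_column j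
    rw [h0] at this
    simp [dot] at this
  · refine hs.add_mem h hj hjl hz.1 fun he => hz.2 ⟨hz.1, ?_⟩
    rw [dotR_toR2, he]

variable {u' p' q' : ℤ × ℤ} {l' L' : ℕ}

theorem column_ne (hs : IsStrip Δ u p q l L) (hs' : IsStrip Δ u' p' q' l' L')
    (h : IsLatticePolytope Δ) (hne : u' ≠ u) {j j' : ℕ} (hj : 1 ≤ j) (hjl : j + l + 1 ≤ L)
    (hjl' : j' + l' + 1 ≤ L') :
    q - p + (j : ℤ) • rot u ≠ q' - p' + (j' : ℤ) • rot u' := by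
  intro he
  have hv := hs.dot_column j
  have hv' := hs'.dot_column j'
  rw [← he] at hv'
  have key : ∀ z ∈ latticePts Δ, dot u' z = dot u' q' → dot u z = dot u q := by
    intro z hz hze
    by_contra hne
    have h1 := hs'.le _ (hs.add_mem h hj hjl hz hne)
    rw [dot_add, hv'] at h1
    omega
  have h1 := key _ hs'.mem rfl
  have h2 := key _ hs'.mem_end (by rw [dot_add, dot_smul, dot_rot, det2_self]; ring)
  rw [dot_add, dot_smul, dot_rot, h1, add_eq_left, mul_eq_zero] at h2
  have h3 : det2 u u' = 0 := by
    have : det2 u' u = 0 := h2.resolve_left (by omega)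
    simp only [det2] at *
    linarith
  rcases IsFan.eq_or_eq_neg_of_det_eq_zero hs.det_rot hs'.det_rot h3 with h4 | h4
  · exact hne h4
  · rw [h4] at hv'
    simp only [dot, Prod.fst_neg, Prod.snd_neg] at hv hv'
    linarith

end IsStrip

namespace IsLatticePolytope

theorem mem_latticePts_of_mem_bdPts (h : IsLatticePolytope Δ) {z : ℤ × ℤ} (hz : z ∈ bdPts Δ) :
    z ∈ latticePts Δ :=
  h.isCompact.isClosed.frontier_subset hz

theorem notMem_intPts_of_mem_bdPts {z : ℤ × ℤ} (hz : z ∈ bdPts Δ) : z ∉ intPts Δ :=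
  hz.2

theorem finite_bdPts_interiorHull (h : IsLatticePolytope Δ) :
    (bdPts (interiorHull Δ)).Finite := by
  refine h.finite_latticePts.subset fun z hz => ?_
  have hsub : interiorHull Δ ⊆ Δ := by
    refine convexHull_min ?_ h.convex
    rintro _ ⟨z, hz, rfl⟩
    exact interior_subset hz
  exact closure_minimal hsub h.isCompact.isClosed (frontier_subset_closure hz)

/-- The lattice points seen from a non-interior one lie on one side of some direction. -/
theorem exists_extreme_direction (h : IsLatticePolytope Δ) {p z : ℤ × ℤ} (hp : p ∈ intPts Δ)
    (hz : z ∉ intPts Δ) :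
    ∃ x ∈ latticePts Δ, x ≠ z ∧ ∀ y ∈ latticePts Δ, 0 ≤ det2 (x - z) (y - z) := by
  obtain ⟨α, β, hlt, hle⟩ := h.exists_separating hp hz
  obtain ⟨f, hf⟩ : ∃ f : ℤ × ℤ → ℝ,
      ∀ x, f x = α * (x.1 - z.1) + β * (x.2 - z.2) := ⟨_, fun _ => rfl⟩
  obtain ⟨g, hg⟩ : ∃ g : ℤ × ℤ → ℝ,
      ∀ x, g x = α * (x.2 - z.2) - β * (x.1 - z.1) := ⟨_, fun _ => rfl⟩
  have hN : 0 < α ^ 2 + β ^ 2 := by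
    by_contra! hN
    have h1 : α = 0 := by nlinarith [sq_nonneg α, sq_nonneg β]
    have h2 : β = 0 := by nlinarith [sq_nonneg α, sq_nonneg β]
    rw [h1, h2] at hlt
    linarith
  have hdet : ∀ x y, 0 ≤ f x * g y - g x * f y → 0 ≤ det2 (x - z) (y - z) := by
    intro x y hxy
    have h1 : f x * g y - g x * f y = (α ^ 2 + β ^ 2) * (det2 (x - z) (y - z) : ℤ) := by
      simp only [hf, hg, det2, Prod.fst_sub, Prod.snd_sub]
      push_cast
      ring
    rw [h1] at hxy
    exact_mod_cast nonneg_of_mul_nonneg_right hxy hN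
  have hfle : ∀ x ∈ latticePts Δ, f x ≤ 0 := by
    intro x hx
    have := hle _ hx
    simp only [toR2] at this
    rw [hf]
    linarith
  have hfz : f z = 0 := by rw [hf]; ring
  have hgz : g z = 0 := by rw [hg]; ring
  by_cases hA : ∃ x ∈ latticePts Δ, f x = 0 ∧ 0 < g x
  · obtain ⟨x, hx, hfx, hgx⟩ := hA
    refine ⟨x, hx, ?_, fun y hy => hdet x y ?_⟩
    · rintro rfl
      exact hgx.ne' hgz
    · rw [hfx]
      nlinarith [hfle y hy]
  · push Not at hA
    have hpf : f p < 0 := by rw [hf]; linarith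
    obtain ⟨x, ⟨hx, hfx⟩, hmax⟩ :=
      (h.finite_latticePts.inter_of_left {x | f x < 0}).exists_maximalFor (fun x => g x / -f x) _
        ⟨p, intPts_subset hp, hpf⟩
    rw [Set.mem_ofPred_eq] at hfx
    refine ⟨x, hx, ?_, fun y hy => hdet x y ?_⟩
    · rintro rfl
      exact hfx.ne hfz
    · rcases (hfle y hy).lt_or_eq with hy0 | hy0
      · have h1 : g y / -f y ≤ g x / -f x := by
          by_contra! hc
          exact absurd (hmax ⟨hy, hy0⟩ hc.le) (not_le.2 hc)
        rw [div_le_div_iff₀ (neg_pos.2 hy0) (neg_pos.2 hfx)] at h1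
        linarith
      · rw [hy0]
        nlinarith [hA y hy hy0]

/-- Every lattice point that is not interior is the first point of a primitive segment
on the boundary. -/
theorem exists_edge (h : IsLatticePolytope Δ) {p z : ℤ × ℤ} (hp : p ∈ intPts Δ)
    (hzΔ : z ∈ latticePts Δ) (hz : z ∉ intPts Δ) :
    ∃ u f, dot u f = 1 ∧ (∀ x ∈ latticePts Δ, dot u x ≤ dot u z) ∧ z + rot u ∈ latticePts Δ := by
  obtain ⟨x, hx, hne, hdet⟩ := h.exists_extreme_direction hp hz
  have hgcd : 0 < Int.gcd (x.1 - z.1) (x.2 - z.2) := by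
    rw [Nat.pos_iff_ne_zero, Ne, Int.gcd_eq_zero_iff]
    rintro ⟨h1, h2⟩
    exact hne (Prod.ext (sub_eq_zero.1 h1) (sub_eq_zero.1 h2))
  obtain ⟨m, n, hmn, h1, h2⟩ := Int.exists_gcd_one hgcd
  generalize Int.gcd (x.1 - z.1) (x.2 - z.2) = g at *
  obtain ⟨a, b, hab⟩ := Int.isCoprime_iff_gcd_eq_one.2 hmn
  have hg0 : (0 : ℤ) < g := by exact_mod_cast hgcd
  refine ⟨(n, -m), (b, -a), ?_, fun y hy => ?_, ?_⟩
  · simp only [dot]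
    linear_combination hab
  · have h3 := hdet y hy
    simp only [det2, Prod.fst_sub, Prod.snd_sub, h1, h2] at h3
    have h4 : 0 ≤ (g : ℤ) * (m * (y.2 - z.2) - n * (y.1 - z.1)) := by linarith
    have h5 := nonneg_of_mul_nonneg_right h4 hg0
    simp only [dot]
    linarith
  · have hg1 : (1 : ℝ) ≤ g := by exact_mod_cast hgcd
    have hg2 : (0 : ℝ) < g := by linarith
    have h3 := h.combo_mem hzΔ hx (t := 1 / g) (by positivity) ((div_le_one hg2).2 hg1)
    have h1' : (x.1 : ℝ) = z.1 + m * g := by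
      have : x.1 = z.1 + m * g := by linarith
      exact_mod_cast this
    have h2' : (x.2 : ℝ) = z.2 + n * g := by
      have : x.2 = z.2 + n * g := by linarith
      exact_mod_cast this
    rw [latticePts, Set.mem_ofPred_eq]
    convert h3 using 1
    ext
    · simp only [toR2, h1', rot, Prod.fst_add]
      push_cast
      field_simp
      ring
    · simp only [toR2, h2', rot, Prod.snd_add]
      push_cast
      field_simp
      ring

theorem mem_adjNormals_of_edge (h : IsLatticePolytope Δ) {u f x z : ℤ × ℤ} (hx : x ∈ intPts Δ)
    (hz : z ∈ latticePts Δ) (huf : dot u f = 1) (hmax : ∀ y ∈ latticePts Δ, dot u y ≤ dot u z)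
    (hedge : z + rot u ∈ latticePts Δ) : u ∈ adjNormals Δ := by
  have hu0 : u ≠ 0 := by
    rintro rfl
    simp [dot] at huf
  obtain ⟨y, hy, hlt⟩ := h.exists_dot_lt hu0 hx
  obtain ⟨k, hk⟩ := Int.eq_ofNat_of_zero_le (show 0 ≤ dot u z - 1 - dot u x by
    have := hmax y hy
    omega)
  obtain ⟨c, hc⟩ : ∃ c, c = det2 f (x - z) := ⟨_, rfl⟩
  have hx1 : x.1 = z.1 - (k + 1) * f.1 - c * u.2 := by
    rw [hc]
    simp only [dot, det2, Prod.fst_sub, Prod.snd_sub] at *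
    linear_combination -f.1 * hk - (x.1 - z.1) * huf
  have hx2 : x.2 = z.2 - (k + 1) * f.2 + c * u.1 := by
    rw [hc]
    simp only [dot, det2, Prod.fst_sub, Prod.snd_sub] at *
    linear_combination -f.2 * hk - (x.2 - z.2) * huf
  have hx1' : (x.1 : ℝ) = z.1 - (k + 1) * f.1 - c * u.2 := by exact_mod_cast hx1
  have hx2' : (x.2 : ℝ) = z.2 - (k + 1) * f.2 + c * u.1 := by exact_mod_cast hx2
  obtain ⟨m, i, hmi, hi0, hik⟩ : ∃ m i : ℤ, m * (k + 1) = c + i ∧ 0 ≤ i ∧ i ≤ k := by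
    refine ⟨-((-c) / (k + 1)), (-c) % (k + 1), ?_, Int.emod_nonneg _ (by positivity), ?_⟩
    · linarith [Int.mul_ediv_add_emod (-c) (k + 1)]
    · have := Int.emod_lt_of_pos (-c) (show (0 : ℤ) < k + 1 by positivity)
      omega
  have hi0' : (0 : ℝ) ≤ i := by exact_mod_cast hi0
  have hik' : (i : ℝ) ≤ k := by exact_mod_cast hik
  have hk0 : (0 : ℝ) ≤ k := Nat.cast_nonneg k
  have hmi' : (m : ℝ) = (c + i) / (k + 1) := by
    rw [eq_div_iff (by positivity)]
    exact_mod_cast hmi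
  have hik0 : (k : ℝ) * (i / k) = i := by
    rcases hk0.eq_or_lt with h0 | h0
    · rw [← h0]
      linarith
    · field_simp
  have hseg := h.combo_mem hz hedge (t := i / k) (by positivity) (div_le_one_of_le₀ hik' hk0)
  refine ⟨hu0, z - f + m • rot u, ?_, fun y hy => ?_⟩
  · refine h.mem_intPts_of_combo hx hseg (t := k / (k + 1)) (by positivity)
      ((div_lt_one (by positivity)).2 (by linarith)) ?_ ?_
    · simp only [toR2, hx1', rot, Prod.fst_add, Prod.fst_sub, Prod.smul_fst, smul_eq_mul]
      push_cast
      rw [hmi']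
      generalize (i : ℝ) / k = s at *
      rw [← hik0]
      field_simp
      ring
    · simp only [toR2, hx2', rot, Prod.snd_add, Prod.snd_sub, Prod.smul_snd, smul_eq_mul]
      push_cast
      rw [hmi']
      generalize (i : ℝ) / k = s at *
      rw [← hik0]
      field_simp
      ring
  · have h1 := hmax y hy
    have h2 : dot u (z - f + m • rot u) = dot u z - 1 := by
      rw [dot_add, dot_smul, dot_rot, det2_self]
      simp only [dot, Prod.fst_sub, Prod.snd_sub] at *
      linear_combination -huf
    omega

theorem finite_columnVectors (h : IsLatticePolytope Δ) (hnh : ¬ IsHyperelliptic Δ) :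
    {v : ℤ × ℤ | IsColumnVector Δ v}.Finite := by
  refine (h.finite_latticePts.image2 (· - ·) h.finite_latticePts).subset ?_
  rintro v ⟨-, τ, ⟨-, hcol, -⟩, hτ⟩
  have hex : ∃ p ∈ intPts Δ, toR2 p ∉ τ := by
    by_contra! hc
    refine hnh (hcol.subset ?_)
    rintro _ ⟨p, hp, rfl⟩
    exact hc p hp
  obtain ⟨p, hp, hpτ⟩ := hex
  exact ⟨p + v, hτ p ⟨interior_subset hp, hpτ⟩, p, intPts_subset hp, add_sub_cancel_left p v⟩

end IsLatticePolytope

namespace IsStrip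

variable {u p q u' p' q' : ℤ × ℤ} {l L l' L' : ℕ}

theorem int_le (hs : IsStrip Δ u p q l L) (h : IsLatticePolytope Δ) {z : ℤ × ℤ}
    (hz : z ∈ intPts Δ) : dot u z ≤ dot u p := by
  obtain ⟨y, hy, hlt⟩ := h.exists_dot_lt hs.ne_zero hz
  have := hs.le y hy
  have := hs.height
  omega

theorem dot_add_smul_rot (u p : ℤ × ℤ) (i : ℤ) : dot u (p + i • rot u) = dot u p := by
  rw [dot_add, dot_smul, dot_rot, det2_self, mul_zero, add_zero]

theorem add_mem_int (hs : IsStrip Δ u p q l L) (h : IsLatticePolytope Δ) {i : ℕ} (hi : i ≤ l) :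
    p + (i : ℤ) • rot u ∈ intPts Δ := by
  rcases hi.lt_or_eq with hlt | rfl
  · have hl : (0 : ℝ) < l := by exact_mod_cast (Nat.zero_le i).trans_lt hlt
    refine hs.add_smul_rot_mem_int h (s := l) ?_ hl.ne' ?_ ?_
    · simpa [toR2, rot] using (show toR2 (p + (l : ℤ) • rot u) ∈ Δ from interior_subset hs.int_end)
    · positivity
    · rw [div_lt_one hl]
      exact_mod_cast hlt
  · exact hs.int_end

theorem add_mem_bdPts (hs : IsStrip Δ u p q l L) (h : IsLatticePolytope Δ) {i : ℕ} (hi : i ≤ l) :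
    p + (i : ℤ) • rot u ∈ bdPts (interiorHull Δ) := by
  refine ⟨subset_closure (subset_convexHull ℝ _ ⟨_, hs.add_mem_int h hi, rfl⟩), fun hint => ?_⟩
  obtain ⟨z, hz, hlt⟩ := exists_dot_lt_of_mem_interior hs.ne_zero hint
  rw [dot_add_smul_rot] at hlt
  exact absurd (hs.int_le h hz) (not_le.2 hlt)

theorem add_int_ne (hs : IsStrip Δ u p q l L) (hs' : IsStrip Δ u' p' q' l' L')
    (h : IsLatticePolytope Δ) (hnh : ¬ IsHyperelliptic Δ) (hne : u' ≠ u) {i i' : ℕ} (hi : i < l)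
    (hi' : i' < l') : p + (i : ℤ) • rot u ≠ p' + (i' : ℤ) • rot u' := by
  intro he
  have hd := dot_add_smul_rot u p i
  have hd' := dot_add_smul_rot u' p' i'
  have h1 := hs'.int_le h (hs.add_mem_int h (i := i + 1) hi)
  have h2 := hs.int_le h (hs'.add_mem_int h (i := i' + 1) hi')
  push_cast at h1 h2
  rw [add_smul, one_smul, ← add_assoc, dot_add, dot_rot] at h1 h2
  rw [he] at h1 hd
  rw [hd'] at h1
  rw [hd] at h2
  have h3 : det2 u u' = 0 := by
    simp only [det2] at *
    linarith
  rcases IsFan.eq_or_eq_neg_of_det_eq_zero hs.det_rot hs'.det_rot h3 with h4 | h4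
  · exact hne h4
  · refine hnh ?_
    rw [IsHyperelliptic, collinear_iff_exists_forall_eq_smul_vadd]
    refine ⟨toR2 p, toR2 (rot u), ?_⟩
    rintro _ ⟨z, hz, rfl⟩
    have h5 := hs.int_le h hz
    have h6 := hs'.int_le h hz
    rw [← hd', h4] at h6
    rw [h4] at hd
    have h7 : dot u z = dot u p := by
      simp only [dot, Prod.fst_neg, Prod.snd_neg] at *
      linarith
    obtain ⟨j, -, hj⟩ := hs.int_range z hz h7
    refine ⟨j, ?_⟩
    rw [hj]
    ext <;> simp [toR2, rot] <;> ring

end IsStrip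

theorem sum_le_ncard_of_injective {ι β : Type*} {A : Set β} (hA : A.Finite) (D : Finset ι)
    (n : ι → ℕ) (g : ι → ℕ → β) (hmem : ∀ w ∈ D, ∀ i < n w, g w i ∈ A)
    (hinj : ∀ w ∈ D, ∀ i < n w, ∀ w' ∈ D, ∀ i' < n w', g w i = g w' i' → w = w' ∧ i = i') :
    ∑ w ∈ D, n w ≤ A.ncard := by
  have hcard : (D.sigma fun w => Finset.range (n w)).card = ∑ w ∈ D, n w := by
    rw [Finset.card_sigma]
    simp
  rw [Set.ncard_eq_toFinset_card A hA, ← hcard]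
  refine Finset.card_le_card_of_injOn (fun x => g x.1 x.2) ?_ ?_
  · rintro ⟨w, i⟩ hx
    simp only [Finset.coe_sigma, Set.mem_sigma_iff, Finset.mem_coe, Finset.mem_range] at hx
    exact hA.mem_toFinset.2 (hmem w hx.1 i hx.2)
  · rintro ⟨w, i⟩ hx ⟨w', i'⟩ hx' he
    simp only [Finset.coe_sigma, Set.mem_sigma_iff, Finset.mem_coe, Finset.mem_range] at hx hx'
    obtain ⟨rfl, rfl⟩ := hinj w hx.1 i hx.2 w' hx'.1 i' hx'.2 he
    rfl

/-- for a 2-dimensional maximal nonhyperelliptic lattice polytope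
`Δ ⊂ ℝ²` one has `r − r⁽¹⁾ − c(Δ) ≤ 6`. -/
theorem boundary_points_minus_columns_le (Δ : Set (ℝ × ℝ))
    (hlat : IsLatticePolytope Δ) (hdim : ¬ Collinear ℝ Δ)
    (hmax : IsMaximalPolytope Δ) (hnh : ¬ IsHyperelliptic Δ) :
    ((bdPts Δ).ncard : ℤ) - ((bdPts (interiorHull Δ)).ncard : ℤ) - (colCount Δ : ℤ) ≤ 6 := by
  obtain ⟨D, S, P, Q, hD, hfan, hcorner⟩ := hlat.exists_isFan
  obtain ⟨x, hx⟩ : (intPts Δ).Nonempty := by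
    by_contra! h0
    refine hnh ?_
    rw [IsHyperelliptic, h0, Set.image_empty]
    exact collinear_empty ℝ _
  have hex : ∀ w ∈ D, ∃ l L : ℕ, IsStrip Δ (S w) (P w) (Q w) l L ∧
      det2 w (S (S w)) = 2 - ((L : ℤ) - l) := by
    intro w hw
    have hSw := (hfan w hw).1
    rw [(hcorner _ hSw).2]
    exact (hcorner w hw).1.exists_isStrip hlat (hcorner w hw).2 (hcorner _ hSw).1
  choose! l L hs hdet using hex
  have hr : (bdPts Δ).ncard ≤ ∑ w ∈ D, L w := by
    classical
    have hsub : bdPts Δ ⊆ (D.biUnion fun w => (Finset.range (L w)).image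
        fun i : ℕ => Q w + (i : ℤ) • rot (S w) : Finset (ℤ × ℤ)) := by
      intro z hz
      have hzΔ := hlat.mem_latticePts_of_mem_bdPts hz
      obtain ⟨u, f, huf, hle, hedge⟩ :=
        hlat.exists_edge hx hzΔ (IsLatticePolytope.notMem_intPts_of_mem_bdPts hz)
      have hu : u ∈ D := by
        rw [← Finset.mem_coe, hD]
        exact hlat.mem_adjNormals_of_edge hx hzΔ huf hle hedge
      obtain ⟨w, hw, rfl⟩ := hfan.exists_pred hu
      have hstrip := hs w hw
      have hface := le_antisymm (hstrip.le z hzΔ) (hle _ hstrip.mem)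
      obtain ⟨i, hi, hzi⟩ := hstrip.range z hzΔ hface
      obtain ⟨j, hj, hzj⟩ := hstrip.range _ hedge
        (by rw [dot_add, dot_rot, det2_self, hface, add_zero])
      have hij : (i : ℤ) + 1 = j := by
        refine smul_rot_left_cancel hstrip.ne_zero (a := Q w) ?_
        rw [← hzj, add_smul, one_smul, ← add_assoc, ← hzi]
      simp only [Finset.coe_biUnion, Finset.coe_image, Set.mem_iUnion]
      exact ⟨w, hw, i, Finset.mem_coe.2 (Finset.mem_range.2 (by omega)), hzi.symm⟩
    calc (bdPts Δ).ncard ≤ _ := Set.ncard_le_ncard hsub (Finset.finite_toSet _)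
      _ = _ := Set.ncard_coe_finset _
      _ ≤ _ := Finset.card_biUnion_le
      _ ≤ _ := Finset.sum_le_sum fun w _ => Finset.card_image_le.trans (Finset.card_range _).le
  have hr1 : ∑ w ∈ D, l w ≤ (bdPts (interiorHull Δ)).ncard := by
    refine sum_le_ncard_of_injective hlat.finite_bdPts_interiorHull D l
      (fun w i => P w + (i : ℤ) • rot (S w))
      (fun w hw i hi => (hs w hw).add_mem_bdPts hlat hi.le) ?_
    intro w hw i hi w' hw' i' hi' he
    by_cases hww : S w' = S w
    · obtain rfl := hfan.injOn hw' hw hww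
      exact ⟨rfl, by exact_mod_cast smul_rot_left_cancel (hs w' hw').ne_zero he⟩
    · exact absurd he ((hs w hw).add_int_ne (hs w' hw') hlat hnh hww hi hi')
  have hc : ∑ w ∈ D, (L w - l w - 1) ≤ colCount Δ := by
    refine sum_le_ncard_of_injective (hlat.finite_columnVectors hnh) D _
      (fun w i => Q w - P w + ((i + 1 : ℕ) : ℤ) • rot (S w))
      (fun w hw i hi => (hs w hw).isColumnVector hlat (by omega) (by omega)) ?_
    intro w hw i hi w' hw' i' hi' he
    by_cases hww : S w' = S w
    · obtain rfl := hfan.injOn hw' hw hww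
      have := smul_rot_left_cancel (hs w' hw').ne_zero he
      exact ⟨rfl, by omega⟩
    · exact absurd he ((hs w hw).column_ne (hs w' hw') hlat hww (by omega) (by omega) (by omega))
  have hr' : ((bdPts Δ).ncard : ℤ) ≤ ∑ w ∈ D, (L w : ℤ) := by exact_mod_cast hr
  have hr1' : ∑ w ∈ D, (l w : ℤ) ≤ (bdPts (interiorHull Δ)).ncard := by exact_mod_cast hr1
  have hc' : ∑ w ∈ D, ((L w - l w - 1 : ℕ) : ℤ) ≤ colCount Δ := by exact_mod_cast hc
  rcases Nat.lt_or_ge 6 D.card with hcard | hcard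
  · have h1 := hfan.sum_det (by omega)
    rw [Finset.sum_congr rfl hdet, Finset.sum_sub_distrib, Finset.sum_sub_distrib,
      Finset.sum_const, nsmul_eq_mul] at h1
    omega
  · have h1 : ∑ w ∈ D, (L w : ℤ) ≤ ∑ w ∈ D, ((l w : ℤ) + ((L w - l w - 1 : ℕ) : ℤ) + 1) :=
      Finset.sum_le_sum fun w _ => by omega
    rw [Finset.sum_add_distrib, Finset.sum_add_distrib, Finset.sum_const, nsmul_eq_mul] at h1
    omega
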